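/- Let A be a unital complex Banach algebra and β : A → A a continuous unital algebra homomorphism with β ∘ β = β. Set J = ker β, J̃ = ℂ·1 + J (the unitization of J, a closed unital subalgebra of A), and B = ran β (a closed unital subalgebra of A, isomorphic to A/J). Suppose B is completely finite. Then rtsr(A) = max{ rtsr(B), rtsr(J̃) }: for every n ≥ 1, Rg_n(A) is dense in A^n if and only if both Rg_n(B) is dense in B^n and Rg_n(J̃) is dense in J̃^n. -/

import Mathlib

/-- `RgDenseIn S n` says that the set `Rg_n(S)` of right-invertible `n`-tuples
with entries in the (unital, closed) subalgebra `S ⊆ A` is dense in `S^n`. -/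
def RgDenseIn {A : Type*} [NormedRing A] (S : Set A) (n : ℕ) : Prop :=
  ∀ a : Fin n → A, (∀ i, a i ∈ S) → ∀ ε : ℝ, 0 < ε →
    ∃ b c : Fin n → A, (∀ i, b i ∈ S) ∧ (∀ i, c i ∈ S) ∧
      (∀ i, ‖a i - b i‖ < ε) ∧ ∑ i, b i * c i = 1

/-- A (unital, closed) subalgebra `S` of `A` is *completely finite* if every row
in `Rg_n(S)` occurs as the first row of a matrix with entries in `S` which is
invertible with inverse having entries in `S`. -/
def CompletelyFiniteIn {A : Type*} [Ring A] (S : Set A) : Prop :=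
  ∀ (n : ℕ) (hn : 1 ≤ n) (a c : Fin n → A),
    (∀ i, a i ∈ S) → (∀ i, c i ∈ S) → ∑ i, a i * c i = 1 →
    ∃ W W' : Matrix (Fin n) (Fin n) A,
      (∀ i j, W i j ∈ S) ∧ (∀ i j, W' i j ∈ S) ∧
      W * W' = 1 ∧ W' * W = 1 ∧
      ∀ j, W ⟨0, Nat.lt_of_lt_of_le Nat.zero_lt_one hn⟩ j = a j

open Topology Filter Matrix

/-- The set `Rg_n(S)` of right-invertible `n`-rows with entries in `S`. -/
def rightInvertibleRows {A : Type*} [Ring A] (S : Set A) (n : ℕ) : Set (Fin n → A) :=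
  {b | (∀ i, b i ∈ S) ∧ ∃ c : Fin n → A, (∀ i, c i ∈ S) ∧ b ⬝ᵥ c = 1}

theorem rgDenseIn_iff_closure {A : Type*} [NormedRing A] {S : Set A} {n : ℕ} :
    RgDenseIn S n ↔
      ∀ a : Fin n → A, (∀ i, a i ∈ S) → a ∈ closure (rightInvertibleRows S n) := by
  refine forall₂_congr fun a _ => ?_
  rw [Metric.mem_closure_iff]
  refine forall₂_congr fun ε hε => ?_
  constructor
  · rintro ⟨b, c, hb, hc, hab, h⟩
    exact ⟨b, ⟨hb, c, hc, h⟩, (dist_pi_lt_iff hε).2 fun i => by simpa [dist_eq_norm] using hab i⟩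
  · rintro ⟨b, ⟨hb, c, hc, h⟩, hab⟩
    exact ⟨b, c, hb, hc, fun i => by simpa [dist_eq_norm] using (dist_pi_lt_iff hε).1 hab i, h⟩

theorem mem_unitization_ker_iff {A : Type*} [Ring A] [Algebra ℂ A] (β : A →ₐ[ℂ] A) (a : A) :
    a ∈ {a : A | ∃ (z : ℂ) (j : A), β j = 0 ∧ a = algebraMap ℂ A z + j} ↔
      ∃ z : ℂ, β a = algebraMap ℂ A z := by
  constructor
  · rintro ⟨z, j, hj, rfl⟩
    exact ⟨z, by simp [hj]⟩
  · rintro ⟨z, hz⟩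
    exact ⟨z, a - algebraMap ℂ A z, by simp [hz], by simp⟩

theorem rightInvertibleRows_vecMul {A : Type*} [Ring A] {n : ℕ} {b : Fin n → A}
    (hb : b ∈ rightInvertibleRows Set.univ n) {W W' : Matrix (Fin n) (Fin n) A}
    (hW : W * W' = 1) : b ᵥ* W ∈ rightInvertibleRows Set.univ n := by
  obtain ⟨-, c, -, h⟩ := hb
  refine ⟨fun _ => trivial, W' *ᵥ c, fun _ => trivial, ?_⟩
  rw [← dotProduct_mulVec, mulVec_mulVec, hW, one_mulVec, h]

theorem rightInvertibleRows_mono {A : Type*} [Ring A] {S T : Set A} (h : S ⊆ T) (n : ℕ) :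
    rightInvertibleRows S n ⊆ rightInvertibleRows T n :=
  fun _ ⟨hb, c, hc, hbc⟩ => ⟨fun i => h (hb i), c, fun i => h (hc i), hbc⟩

/-- If `β b` is close to a scalar row `z` with `z k ≠ 0`, this correction of `b` is mapped by `β`
to exactly `z`. -/
noncomputable def scalarCorrection {A : Type*} [Ring A] [Algebra ℂ A] (β : A →ₐ[ℂ] A) {n : ℕ}
    (z : Fin n → ℂ) (k : Fin n) (b : Fin n → A) (i : Fin n) : A :=
  b i - (z k)⁻¹ • b k * Ring.inverse ((z k)⁻¹ • β (b k)) * (β (b i) - algebraMap ℂ A (z i))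

section Correction

variable {A : Type*} [Ring A] [Algebra ℂ A] {β : A →ₐ[ℂ] A} {n : ℕ}
  {z : Fin n → ℂ} {k : Fin n} {b : Fin n → A}

theorem map_ringInverse_of_fixed {u : A} (hu : IsUnit u) (h : β u = u) :
    β (Ring.inverse u) = Ring.inverse u := by
  refine hu.mul_left_cancel ?_
  rw [Ring.mul_inverse_cancel _ hu]
  nth_rw 1 [← h]
  rw [← map_mul, Ring.mul_inverse_cancel _ hu, map_one]

theorem map_scalarCorrection (hβ2 : ∀ a, β (β a) = β a) (hu : IsUnit ((z k)⁻¹ • β (b k)))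
    (i : Fin n) : β (scalarCorrection β z k b i) = algebraMap ℂ A (z i) := by
  have h : β (Ring.inverse ((z k)⁻¹ • β (b k))) = Ring.inverse ((z k)⁻¹ • β (b k)) :=
    map_ringInverse_of_fixed hu (by simp [hβ2])
  simp only [scalarCorrection, map_sub, map_mul, h, map_smul, hβ2, AlgHom.commutes]
  rw [Ring.mul_inverse_cancel _ hu]
  simp

theorem exists_rightInverse_scalarCorrection (hz : z k ≠ 0) (hu : IsUnit ((z k)⁻¹ • β (b k)))
    (hb : b ∈ rightInvertibleRows Set.univ n) :
    ∃ e : Fin n → A, scalarCorrection β z k b ⬝ᵥ e = 1 := by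
  obtain ⟨-, f, -, hf⟩ := hb
  set d : Fin n → A := fun i => β (b i) - algebraMap ℂ A (z i) with hd
  set u := (z k)⁻¹ • β (b k) with hu'
  have hF : scalarCorrection β z k b = b - ((z k)⁻¹ • b k * Ring.inverse u) • d := by
    ext i
    simp [scalarCorrection, hd, hu']
  have hdk : (z k)⁻¹ • d k = u - 1 := by
    simp [hd, hu', smul_sub, Algebra.algebraMap_eq_smul_one, smul_smul, hz]
  refine ⟨f + Pi.single k ((z k)⁻¹ • (d ⬝ᵥ f)), ?_⟩
  rw [hF, sub_dotProduct, dotProduct_add, smul_dotProduct, dotProduct_add, hf,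
    dotProduct_single, dotProduct_single, mul_smul_comm, mul_smul_comm, ← smul_mul_assoc,
    ← smul_mul_assoc, hdk]
  have hvu : Ring.inverse u * u = 1 := Ring.inverse_mul_cancel _ hu
  simp only [smul_eq_mul, sub_mul, one_mul, add_sub_cancel]
  rw [mul_assoc _ (Ring.inverse u), ← mul_assoc (Ring.inverse u), hvu, one_mul, add_sub_cancel_right]

/-- A row with right inverse `e` whose image under `β` is a nonzero scalar row has a right inverse
whose image under `β` is a scalar column as well. -/
theorem exists_rightInverse_map_scalar (hz : z k ≠ 0) (hβb : ∀ i, β (b i) = algebraMap ℂ A (z i))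
    {e : Fin n → A} (he : b ⬝ᵥ e = 1) :
    ∃ e' : Fin n → A, (∀ i, ∃ w : ℂ, β (e' i) = algebraMap ℂ A w) ∧ b ⬝ᵥ e' = 1 := by
  refine ⟨fun i => e i + ((Pi.single k (algebraMap ℂ A (z k)⁻¹) : Fin n → A) i
    - e i * (b k * algebraMap ℂ A (z k)⁻¹)), fun i => ⟨(Pi.single k (z k)⁻¹ : Fin n → ℂ) i, ?_⟩, ?_⟩
  · have hs : (Pi.single k (algebraMap ℂ A (z k)⁻¹) : Fin n → A) i
        = algebraMap ℂ A ((Pi.single k (z k)⁻¹ : Fin n → ℂ) i) := by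
      by_cases h : i = k
      · subst h; simp
      · simp [h]
    beta_reduce
    rw [hs]
    simp only [map_add, map_sub, map_mul, hβb, AlgHom.commutes]
    rw [← map_mul, mul_inv_cancel₀ hz]
    simp
  · have h1 : b ⬝ᵥ (fun i => e i * (b k * algebraMap ℂ A (z k)⁻¹))
        = b k * algebraMap ℂ A (z k)⁻¹ := by
      simp only [dotProduct, ← mul_assoc, ← Finset.sum_mul] at he ⊢
      rw [he, one_mul]
    change b ⬝ᵥ (e + (Pi.single k (algebraMap ℂ A (z k)⁻¹)
      - fun i => e i * (b k * algebraMap ℂ A (z k)⁻¹))) = 1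
    rw [dotProduct_add, dotProduct_sub, h1, dotProduct_single, he, sub_self, add_zero]

end Correction

section Banach

variable {A : Type*} [NormedRing A] [NormedAlgebra ℂ A] {β : A →ₐ[ℂ] A} {n : ℕ}

theorem RgDenseIn.range_of_univ (hβc : Continuous β) (hβ2 : ∀ a, β (β a) = β a)
    (h : RgDenseIn (Set.univ : Set A) n) : RgDenseIn (Set.range β) n := by
  rw [rgDenseIn_iff_closure] at h ⊢
  intro a ha
  have hβa : (fun i => β (a i)) = a := by
    ext i
    obtain ⟨x, hx⟩ := ha i
    rw [← hx, hβ2]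
  rw [← hβa]
  refine map_mem_closure (f := fun (b : Fin n → A) i => β (b i)) (by fun_prop)
    (h a fun _ => trivial) ?_
  rintro b ⟨-, c, -, hbc⟩
  exact ⟨fun i => ⟨_, rfl⟩, fun i => β (c i), fun i => ⟨_, rfl⟩, by
    simpa [dotProduct] using congrArg β hbc⟩

theorem mem_closure_unitization_of_ne_zero [CompleteSpace A] (hβc : Continuous β)
    (hβ2 : ∀ a, β (β a) = β a) {a : Fin n → A} {z : Fin n → ℂ} {k : Fin n} (hz : z k ≠ 0)
    (hβa : ∀ i, β (a i) = algebraMap ℂ A (z i))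
    (ha : a ∈ closure (rightInvertibleRows Set.univ n)) :
    a ∈ closure (rightInvertibleRows
      {a : A | ∃ (z : ℂ) (j : A), β j = 0 ∧ a = algebraMap ℂ A z + j} n) := by
  have hu : (z k)⁻¹ • β (a k) = 1 := by
    rw [hβa, Algebra.algebraMap_eq_smul_one, smul_smul, inv_mul_cancel₀ hz, one_smul]
  have hFa : scalarCorrection β z k a = a := by
    ext i
    simp [scalarCorrection, hβa]
  have hcu : Continuous fun b : Fin n → A => (z k)⁻¹ • β (b k) := by fun_prop
  have hcF : ContinuousAt (scalarCorrection β z k) a := by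
    refine continuousAt_pi.2 fun i => ?_
    have hinv : ContinuousAt (fun b : Fin n → A => Ring.inverse ((z k)⁻¹ • β (b k))) a := by
      refine ContinuousAt.comp (g := Ring.inverse) ?_ hcu.continuousAt
      rw [hu]
      exact NormedRing.inverse_continuousAt 1
    have h1 : ContinuousAt (fun b : Fin n → A => (z k)⁻¹ • b k) a :=
      ((continuous_apply k).const_smul _).continuousAt
    have h2 : ContinuousAt (fun b : Fin n → A => b i) a := (continuous_apply i).continuousAt
    have h3 : ContinuousAt (fun b : Fin n → A => β (b i) - algebraMap ℂ A (z i)) a :=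
      ((hβc.comp (continuous_apply i)).sub continuous_const).continuousAt
    exact h2.sub ((h1.mul hinv).mul h3)
  have hunit : ∀ᶠ b in 𝓝 a, IsUnit ((z k)⁻¹ • β (b k)) :=
    hcu.continuousAt.eventually_mem (Units.isOpen.mem_nhds (by
      rw [Set.mem_ofPred_eq, hu]
      exact isUnit_one))
  rw [mem_closure_iff_frequently] at ha ⊢
  have hT : Tendsto (scalarCorrection β z k) (𝓝 a) (𝓝 a) := by
    simpa only [ContinuousAt, hFa] using hcF
  refine hT.frequently ((ha.and_eventually hunit).mono ?_)
  rintro b ⟨hb, hbu⟩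
  have hmap := map_scalarCorrection hβ2 hbu
  obtain ⟨e, he⟩ := exists_rightInverse_scalarCorrection hz hbu hb
  obtain ⟨e', he', hbe⟩ := exists_rightInverse_map_scalar hz hmap he
  exact ⟨fun i => (mem_unitization_ker_iff β _).2 ⟨_, hmap i⟩, e',
    fun i => (mem_unitization_ker_iff β _).2 (he' i), hbe⟩

theorem RgDenseIn.unitization_of_univ [CompleteSpace A] (hβc : Continuous β)
    (hβ2 : ∀ a, β (β a) = β a) (hn : 1 ≤ n) (h : RgDenseIn (Set.univ : Set A) n) :
    RgDenseIn {a : A | ∃ (z : ℂ) (j : A), β j = 0 ∧ a = algebraMap ℂ A z + j} n := by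
  rw [rgDenseIn_iff_closure] at h ⊢
  intro a ha
  choose z j hj hz using ha
  let k : Fin n := ⟨0, hn⟩
  let g : ℂ → Fin n → A := fun t i => algebraMap ℂ A (Function.update z k t i) + j i
  have hg : Continuous g := by
    refine continuous_pi fun i => ?_
    have : Continuous fun t : ℂ => Function.update z k t i :=
      (continuous_apply i).comp
        ((continuous_const (y := z)).update k continuous_id)
    exact ((algebraMapCLM ℂ A).continuous.comp this).add continuous_const
  have hga : g (z k) = a := by
    ext i
    simp [g, hz i]
  have hd : z k ∈ closure ({0}ᶜ : Set ℂ) := dense_compl_singleton 0 (z k)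
  rw [← hga, ← closure_closure]
  refine map_mem_closure hg hd fun t ht => ?_
  exact mem_closure_unitization_of_ne_zero (z := Function.update z k t) (k := k) hβc hβ2
    (by simpa using ht) (fun i => by simp [g, hj]) (h _ fun _ => trivial)

theorem RgDenseIn.univ_of_split (hβ2 : ∀ a, β (β a) = β a)
    (hB : CompletelyFiniteIn (Set.range β)) (hn : 1 ≤ n) (h₁ : RgDenseIn (Set.range β) n)
    (h₂ : RgDenseIn {a : A | ∃ (z : ℂ) (j : A), β j = 0 ∧ a = algebraMap ℂ A z + j} n) :
    RgDenseIn (Set.univ : Set A) n := by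
  rw [rgDenseIn_iff_closure] at h₁ h₂ ⊢
  have hfix : ∀ x ∈ Set.range β, β x = x := by
    rintro _ ⟨x, rfl⟩
    exact hβ2 x
  have key : ∀ a : Fin n → A, (fun i => β (a i)) ∈ rightInvertibleRows (Set.range β) n →
      a ∈ closure (rightInvertibleRows Set.univ n) := by
    rintro a ⟨hr, c, hc, hrc⟩
    obtain ⟨W, W', -, hW'B, hWW', hW'W, hrow⟩ := hB n hn _ c hr hc hrc
    have hmem : a ᵥ* W' ∈ closure (rightInvertibleRows
        {a : A | ∃ (z : ℂ) (j : A), β j = 0 ∧ a = algebraMap ℂ A z + j} n) := by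
      refine h₂ _ fun i => (mem_unitization_ker_iff β _).2
        ⟨(1 : Matrix (Fin n) (Fin n) ℂ) ⟨0, hn⟩ i, ?_⟩
      have : β ((a ᵥ* W') i) = (W * W') ⟨0, hn⟩ i := by
        simp only [vecMul, dotProduct, map_sum, map_mul, mul_apply, hrow]
        exact Finset.sum_congr rfl fun l _ => by rw [hfix _ (hW'B l i)]
      rw [this, hWW', one_apply, one_apply]
      split_ifs <;> simp
    have ha : (a ᵥ* W') ᵥ* W = a := by rw [vecMul_vecMul, hW'W, vecMul_one]
    rw [← ha]
    refine map_mem_closure (f := fun x : Fin n → A => x ᵥ* W)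
      (continuous_id.matrix_vecMul continuous_const) hmem fun b hb => ?_
    exact rightInvertibleRows_vecMul (rightInvertibleRows_mono (Set.subset_univ _) n hb) hWW'
  intro a _
  have hβa := h₁ (fun i => β (a i)) fun i => ⟨_, rfl⟩
  have ha : a = (fun i => a i - β (a i) + β (a i)) := by simp
  rw [ha, ← closure_closure]
  refine map_mem_closure (f := fun (x : Fin n → A) i => a i - β (a i) + x i) (by fun_prop) hβa
    fun r hr => key _ ?_
  have : (fun i => β (a i - β (a i) + r i)) = r := by
    ext i
    simp [hβ2, hfix _ (hr.1 i)]
  rwa [this]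

end Banach

/-- **Theorem (split exact sequences, part (iii)).**  Let `β : A → A` be a
continuous idempotent unital algebra endomorphism of a unital complex Banach
algebra `A`, with `J = ker β`, `J̃ = ℂ·1 + J` and `B = ran β ≅ A/J`.  If `B` is
completely finite, then `rtsr(A) = max{rtsr(B), rtsr(J̃)}`: for every `n ≥ 1`,
`Rg_n(A)` is dense in `A^n` iff both `Rg_n(B)` is dense in `B^n` and `Rg_n(J̃)`
is dense in `J̃^n`. -/
theorem rtsr_eq_max_of_split_completelyFinite
    {A : Type*} [NormedRing A] [NormedAlgebra ℂ A] [CompleteSpace A]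
    (β : A →ₐ[ℂ] A) (hβc : Continuous β) (hβ2 : ∀ a, β (β a) = β a)
    (hB : CompletelyFiniteIn (Set.range β))
    (n : ℕ) (hn : 1 ≤ n) :
    RgDenseIn (Set.univ : Set A) n ↔
      (RgDenseIn (Set.range β) n ∧
       RgDenseIn {a : A | ∃ (z : ℂ) (j : A), β j = 0 ∧ a = algebraMap ℂ A z + j} n) := by
  exact ⟨fun h => ⟨h.range_of_univ hβc hβ2, h.unitization_of_univ hβc hβ2 hn⟩,
    fun h => .univ_of_split hβ2 hB hn h.1 h.2⟩
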